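/- If C is a semi-algebra (i.e., N ∈ C and for every S ∈ C with S ≠ N also N∖S ∈ C), then C is hierarchical: the elements of C can be arranged in a sequence S_1, …, S_l such that for every k = 2, …, l, (i) S_1 meets S_k, and (ii) there exists T ∈ C which misses S_k and meets each of S_1, …, S_{k−1}. -/

import Mathlib

open Finset
open scoped Classical

/-! Common definitions: games on a collection `C` of coalitions of a finite
player set `N`, MM-games, full span, assignments, representations, the
equitable solution, and the Shapley value. -/

/-- The MM-game `w_S`, as a vector in `ℝ^C`:
`w_S(T) = 1` if `S` meets `T` (i.e. `S ∩ T ≠ ∅`) and `0` if `S` misses `T`. -/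
noncomputable def mmGame {N : Type} [DecidableEq N] (C : Finset (Finset N))
    (S : Finset N) : {T : Finset N // T ∈ C} → ℝ :=
  fun T => if (S ∩ T.1).Nonempty then 1 else 0

/-- `C` has full span: the family of MM-games `{w_S}_{S ∈ C}` is a basis of `ℝ^C`,
i.e. it is linearly independent and spans `ℝ^C`. -/
def FullSpan {N : Type} [DecidableEq N] (C : Finset (Finset N)) : Prop :=
  LinearIndependent ℝ (fun S : {S : Finset N // S ∈ C} => mmGame C S.1) ∧
  Submodule.span ℝ (Set.range fun S : {S : Finset N // S ∈ C} => mmGame C S.1) = ⊤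

/-- The full user-set `ψ⁻¹(k) = {n ∈ N : k ∈ ψ(n)}` of facility `k`. -/
noncomputable def userSet {N K : Type} [Fintype N] (ψ : N → Finset K) (k : K) :
    Finset N :=
  Finset.univ.filter fun n => k ∈ ψ n

/-- `(ψ, γ)` is a representation of the game `v : C → ℝ`.  The set of facilities
is `K = ψ(N) = ⋃_{n ∈ N} ψ(n)` (every facility has a nonempty full user-set);
we require `ψ⁻¹(k) ∈ C` for every facility `k`, and
`v(S) = ∑_{k ∈ ψ(S)} γ(k)` for every `S ∈ C`, where `ψ(S) = ⋃_{n ∈ S} ψ(n)`. -/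
def IsRep {N : Type} [Fintype N] [DecidableEq N] (C : Finset (Finset N))
    (v : {T : Finset N // T ∈ C} → ℝ) {K : Type} (ψ : N → Finset K)
    (γ : K → ℝ) : Prop :=
  (∀ k ∈ Finset.univ.biUnion ψ, userSet ψ k ∈ C) ∧
  ∀ T : {T : Finset N // T ∈ C}, v T = ∑ k ∈ T.1.biUnion ψ, γ k

/-- The equitable solution `τ(ψ, γ) ∈ ℝ^N`:
`τ_n(ψ,γ) = ∑_{k ∈ ψ(n)} γ(k)/|ψ⁻¹(k)|`. -/
noncomputable def tau {N K : Type} [Fintype N] (ψ : N → Finset K) (γ : K → ℝ)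
    (n : N) : ℝ :=
  ∑ k ∈ ψ n, γ k / ((userSet ψ k).card : ℝ)

/-- The Shapley value `φ_n(v)` of a game on all coalitions of `N`
(`v ∅` is understood to be `0`):
`φ_n(v) = ∑_{S ⊆ N∖{n}} (|S|!(|N|−1−|S|)!/|N|!)·(v(S∪{n}) − v(S))`. -/
noncomputable def shapley {N : Type} [Fintype N] [DecidableEq N]
    (v : Finset N → ℝ) (n : N) : ℝ :=
  ∑ S ∈ (Finset.univ.erase n).powerset,
    ((S.card.factorial : ℝ) * ((Fintype.card N - 1 - S.card).factorial : ℝ) /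
      ((Fintype.card N).factorial : ℝ)) * (v (insert n S) - v S)

/-- `C` is a semi-algebra: `N ∈ C`, and `N∖S ∈ C` for every `S ∈ C` with `S ≠ N`. -/
def IsSemiAlgebra {N : Type} [Fintype N] [DecidableEq N]
    (C : Finset (Finset N)) : Prop :=
  Finset.univ ∈ C ∧ ∀ S ∈ C, S ≠ Finset.univ → Finset.univ \ S ∈ C

/-- `C` is hierarchical: its elements can be arranged in a sequence
`S_1, …, S_l` such that for every `k = 2, …, l`, (i) `S_1` meets `S_k`, and
(ii) some `T ∈ C` misses `S_k` and meets each of `S_1, …, S_{k−1}`.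
(Indices are `0, …, l-1` here, with `S_1` the element of index `0`.) -/
def IsHierarchy {N : Type} [DecidableEq N] (C : Finset (Finset N)) : Prop :=
  ∃ (l : ℕ) (hl : 0 < l) (S : Fin l → Finset N),
    Function.Injective S ∧ (∀ k, S k ∈ C) ∧ (∀ T ∈ C, ∃ k, S k = T) ∧
    ∀ k : Fin l, 0 < (k : ℕ) →
      ((S ⟨0, hl⟩ ∩ S k).Nonempty ∧
       ∃ T ∈ C, T ∩ S k = ∅ ∧
         ∀ j : Fin l, (j : ℕ) < (k : ℕ) → (T ∩ S j).Nonempty)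

/-- Players `i` and `j` are symmetric in the game `v : C → ℝ`. -/
def SymmetricPlayers {N : Type} [DecidableEq N] (C : Finset (Finset N))
    (v : {T : Finset N // T ∈ C} → ℝ) (i j : N) : Prop :=
  ∀ T : Finset N, i ∉ T → j ∉ T →
    (insert i T ∈ C ↔ insert j T ∈ C) ∧
    ∀ (hi : insert i T ∈ C) (hj : insert j T ∈ C),
      v ⟨insert i T, hi⟩ = v ⟨insert j T, hj⟩

/-- Player `i` is a dummy in the game `v : C → ℝ`. -/
def DummyPlayer {N : Type} [DecidableEq N] (C : Finset (Finset N))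
    (v : {T : Finset N // T ∈ C} → ℝ) (i : N) : Prop :=
  (∀ h : ({i} : Finset N) ∈ C, v ⟨{i}, h⟩ = 0) ∧
  ∀ T : Finset N, T.Nonempty → i ∉ T →
    (insert i T ∈ C ↔ T ∈ C) ∧
    ∀ (hiT : insert i T ∈ C) (hT : T ∈ C), v ⟨insert i T, hiT⟩ = v ⟨T, hT⟩

/-- If `C` is a semi-algebra, then `C` is hierarchical. -/
theorem semiAlgebra_imp_hierarchical {N : Type} [Fintype N] [DecidableEq N]
    [Nonempty N] (C : Finset (Finset N)) (hCne : C.Nonempty)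
    (hmem : ∀ S ∈ C, S.Nonempty) (hcover : ∀ n : N, ∃ S ∈ C, n ∈ S)
    (hsa : IsSemiAlgebra C) : IsHierarchy C := by
  obtain ⟨huniv, hcompl⟩ := hsa
  let e := C.equivFin.symm
  let f : Fin C.card → ℕ := fun i => ((e i).1)ᶜ.card
  let σ := Tuple.sort f
  have hmono : Monotone (f ∘ σ) := Tuple.monotone_sort f
  have hl : 0 < C.card := Finset.card_pos.mpr hCne
  let S : Fin C.card → Finset N := fun i => (e (σ i)).1
  have hinj : Function.Injective S := by
    intro a b h
    exact σ.injective (e.injective (Subtype.ext h))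
  have hS : ∀ k, S k ∈ C := fun k => (e (σ k)).2
  have hsurj : ∀ T ∈ C, ∃ k, S k = T := by
    intro T hT
    refine ⟨σ.symm (e.symm ⟨T, hT⟩), ?_⟩
    simp [S]
  -- an earlier set is never contained in a later one
  have hsub : ∀ j k : Fin C.card, j < k → ¬ S j ⊆ S k := by
    intro j k hjk h
    have h1 : (S j)ᶜ.card ≤ (S k)ᶜ.card := hmono hjk.le
    have h2 : (S k)ᶜ = (S j)ᶜ :=
      Finset.eq_of_subset_of_card_le (Finset.compl_subset_compl.mpr h) h1
    exact hjk.ne' (hinj (compl_injective h2))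
  have hzero : S ⟨0, hl⟩ = Finset.univ := by
    obtain ⟨m, hm⟩ := hsurj _ huniv
    by_cases h0 : (m : ℕ) = 0
    · rw [← hm]
      congr 1
      exact Fin.ext h0.symm
    · exact absurd (by rw [hm]; exact Finset.subset_univ _)
        (hsub ⟨0, hl⟩ m (Fin.lt_def.mpr (Nat.pos_of_ne_zero h0)))
  refine ⟨C.card, hl, S, hinj, hS, hsurj, ?_⟩
  intro k hk
  refine ⟨?_, Finset.univ \ S k, hcompl _ (hS k) ?_, ?_, ?_⟩
  · rw [hzero, Finset.univ_inter]
    exact hmem _ (hS k)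
  · intro h
    have := hinj (h.trans hzero.symm)
    rw [this] at hk
    exact absurd hk (lt_irrefl _)
  · exact Finset.sdiff_inter_self _ _
  · intro j hj
    obtain ⟨x, hx, hx'⟩ := Finset.not_subset.mp (hsub j k hj)
    exact ⟨x, by simp [hx, hx']⟩
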